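/- Let Λ be a finite subset of ℕ ∪ {0}, let α ≥ -1 and p > 2. Then the supremum of ‖f‖_{A^p_{(p/2)(α+2)−2}} over all f holomorphic on 𝔻 with ‖f‖_{A²_α} ≤ 1 is equal to the supremum of ‖f‖_{A^p_{(p/2)(α+2)−2}} over all f holomorphic on 𝔻 with ‖f‖_{A²_α} ≤ 1 and f^{(j)}(0) = 0 for every j ∈ Λ. -/

import Mathlib

open MeasureTheory Set Filter
open scoped ENNReal NNReal Topology

noncomputable section

/-- The open unit disk in `ℂ`. -/
def unitDisk : Set ℂ := Metric.ball 0 1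

/-- `c_β(n) = Γ(n+β)/(Γ(β)·n!)`. -/
def ccoef (β : ℝ) (n : ℕ) : ℝ := Real.Gamma (n + β) / (Real.Gamma β * n.factorial)

/-- The `n`-th Taylor coefficient of `f` at the origin. -/
def taylorCoeff (f : ℂ → ℂ) (n : ℕ) : ℂ := iteratedDeriv n f 0 / n.factorial

/-- The square of the `A²_α` norm, `∑ |a_n|²/c_{α+2}(n)`, valued in `[0,∞]`. -/
def A2normSq (α : ℝ) (f : ℂ → ℂ) : ℝ≥0∞ :=
  ∑' n : ℕ, ENNReal.ofReal (‖taylorCoeff f n‖ ^ 2 / ccoef (α + 2) n)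

/-- The `A²_α` norm (Hardy `H²` norm when `α = -1`). -/
def A2norm (α : ℝ) (f : ℂ → ℂ) : ℝ≥0∞ := A2normSq α f ^ (1 / 2 : ℝ)

/-- The `p`-th power of the weighted Bergman norm `‖f‖_{A^p_β}`, valued in `[0,∞]`:
`(β+1) ∫_𝔻 (1-|z|²)^β |f z|^p dA(z)` with `dA` the normalized area measure. -/
def ApIntPow (p β : ℝ) (f : ℂ → ℂ) : ℝ≥0∞ :=
  ENNReal.ofReal (β + 1) *
    (∫⁻ z in unitDisk, ENNReal.ofReal ((1 - ‖z‖ ^ 2) ^ β * ‖f z‖ ^ p)) / ENNReal.ofReal Real.pi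

/-- The weighted Bergman norm `‖f‖_{A^p_β}`, valued in `[0,∞]`. -/
def ApNorm (p β : ℝ) (f : ℂ → ℂ) : ℝ≥0∞ := ApIntPow p β f ^ (1 / p)

/-- The inner integral `∫₀¹ s^{α+1}/(1-(1-|z|²)s) ds`, valued in `[0,∞]`. -/
def Hinner (α : ℝ) (z : ℂ) : ℝ≥0∞ :=
  ∫⁻ s in Set.Ioo (0 : ℝ) 1, ENNReal.ofReal (s ^ (α + 1) / (1 - (1 - ‖z‖ ^ 2) * s))

/-- The quantity `F_p(f)`. -/
def Ffun (α p : ℝ) (f : ℂ → ℂ) : ℝ≥0∞ :=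
  ENNReal.ofReal (‖f 0‖ ^ p) +
    ENNReal.ofReal (p / 2) *
      (∫⁻ z in unitDisk,
        ENNReal.ofReal (‖deriv f z‖ ^ 2 * ‖f z‖ ^ (p - 2) * (1 - ‖z‖ ^ 2) ^ (p * (α + 2) / 2)) *
          Hinner α z) / ENNReal.ofReal Real.pi

/-- The quantity `G_p(f)`. -/
def Gfun (α p : ℝ) (f : ℂ → ℂ) : ℝ≥0∞ :=
  ENNReal.ofReal (p / (2 * (α + 2))) *
    (∫⁻ z in unitDisk,
      ENNReal.ofReal (‖deriv f z‖ ^ 2 * ‖f z‖ ^ (p - 2) * (1 - ‖z‖ ^ 2) ^ (p * (α + 2) / 2))) /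
    ENNReal.ofReal Real.pi

section Coefficients

variable {γ : ℝ}

lemma ccoef_pos (hγ : 0 < γ) (n : ℕ) : 0 < ccoef γ n := by
  have h1 := Real.Gamma_pos_of_pos hγ
  have h2 : 0 < Real.Gamma (n + γ) := Real.Gamma_pos_of_pos (by positivity)
  unfold ccoef
  positivity

lemma ccoef_eq_choose (hγ : 0 < γ) (n : ℕ) :
    (ccoef γ n : ℂ) = Ring.choose ((γ : ℂ) + n - 1) n := by
  have h := Complex.Gamma_add_nat_div_Gamma_eq (n := n) (γ : ℂ) (by
    intro k hk
    have : γ = -k := by exact_mod_cast hk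
    have : (0 : ℝ) ≤ k := k.cast_nonneg
    linarith)
  have h2 := Ring.factorial_nsmul_multichoose_eq_ascPochhammer (γ : ℂ) n
  rw [Ring.multichoose_eq,
    Polynomial.ascPochhammer_smeval_eq_eval, ← h,
    nsmul_eq_mul] at h2
  have hn : (n.factorial : ℂ) ≠ 0 := by exact_mod_cast n.factorial_ne_zero
  rw [← mul_right_inj' hn, h2]
  have hG : (Real.Gamma γ : ℂ) ≠ 0 := by exact_mod_cast (Real.Gamma_pos_of_pos hγ).ne'
  have e1 : Complex.Gamma ((γ : ℂ) + n) = (Real.Gamma (n + γ) : ℂ) := by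
    rw [← Complex.Gamma_ofReal]; push_cast; ring_nf
  rw [e1, Complex.Gamma_ofReal]
  unfold ccoef
  push_cast
  field_simp

lemma hasSum_ccoef (hγ : 0 < γ) {z : ℂ} (hz : ‖z‖ < 1) :
    HasSum (fun n : ℕ => (ccoef γ n : ℂ) * z ^ n) (1 / (1 - z) ^ (γ : ℂ)) := by
  have h := (Complex.one_div_one_sub_cpow_hasFPowerSeriesOnBall_zero (γ : ℂ)).hasSum (y := z)
    (by simpa [Metric.mem_eball, enorm_eq_nnnorm, ← NNReal.coe_lt_coe] using hz)
  simpa [FormalMultilinearSeries.ofScalars_apply_eq, ccoef_eq_choose hγ, mul_comm] using h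

lemma summable_ccoef (hγ : 0 < γ) {r : ℝ} (hr0 : 0 ≤ r) (hr : r < 1) :
    Summable (fun n : ℕ => ccoef γ n * r ^ n) := by
  have h := (hasSum_ccoef hγ (z := (r : ℂ)) (by simpa [abs_of_nonneg hr0] using hr)).summable
  exact_mod_cast h

/-- The Hilbert space of square summable sequences; a sequence `b` stands for the function
`∑ b_n √(c_γ(n)) z^n`. -/
abbrev SeqSpace : Type := lp (fun _ : ℕ => ℂ) 2

lemma memℓp_kernel (hγ : 0 < γ) {w : ℂ} (hw : ‖w‖ < 1) :
    Memℓp (fun n : ℕ => (√(ccoef γ n) : ℂ) * (starRingEnd ℂ w) ^ n) 2 := by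
  refine memℓp_gen ?_
  have h := summable_ccoef hγ (r := ‖w‖ ^ 2) (by positivity)
    (by nlinarith [norm_nonneg w])
  refine h.congr fun n => ?_
  simp only [ENNReal.toReal_ofNat, Real.rpow_ofNat, norm_mul, norm_pow, RCLike.norm_conj,
    Complex.norm_real, Real.norm_eq_abs, mul_pow, sq_abs, Real.sq_sqrt (ccoef_pos hγ n).le]
  ring

open Classical in
/-- The reproducing kernel vector at `w`, equal to `0` when `w` is outside the disk. -/
def kerVec (γ : ℝ) (w : ℂ) : SeqSpace :=
  if h : Memℓp (fun n : ℕ => (√(ccoef γ n) : ℂ) * (starRingEnd ℂ w) ^ n) 2 then ⟨_, h⟩ else 0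

lemma kerVec_apply (hγ : 0 < γ) {w : ℂ} (hw : ‖w‖ < 1) (n : ℕ) :
    kerVec γ w n = (√(ccoef γ n) : ℂ) * (starRingEnd ℂ w) ^ n := by
  rw [kerVec, dif_pos (memℓp_kernel hγ hw)]

/-- The function on the disk represented by a square summable sequence. -/
def toFun (γ : ℝ) (b : SeqSpace) (z : ℂ) : ℂ := inner ℂ (kerVec γ z) b

lemma hasSum_toFun (hγ : 0 < γ) (b : SeqSpace) {z : ℂ} (hz : ‖z‖ < 1) :
    HasSum (fun n : ℕ => (√(ccoef γ n) * b n : ℂ) * z ^ n) (toFun γ b z) := by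
  refine (lp.hasSum_inner (kerVec γ z) b).congr_fun fun n => ?_
  simp [kerVec_apply hγ hz]
  ring

lemma toFun_kerVec (hγ : 0 < γ) {z w : ℂ} (hz : ‖z‖ < 1) (hw : ‖w‖ < 1) :
    toFun γ (kerVec γ w) z = 1 / (1 - starRingEnd ℂ w * z) ^ (γ : ℂ) := by
  refine (hasSum_toFun hγ (kerVec γ w) hz).unique ?_
  have h := hasSum_ccoef hγ (z := starRingEnd ℂ w * z) (by
    rw [norm_mul, RCLike.norm_conj]; nlinarith [norm_nonneg z, norm_nonneg w])
  refine h.congr_fun fun n => ?_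
  have h2 : (√(ccoef γ n) : ℂ) * √(ccoef γ n) = ccoef γ n := by
    exact_mod_cast Real.mul_self_sqrt (ccoef_pos hγ n).le
  rw [kerVec_apply hγ hw, mul_pow, ← h2]
  ring

lemma hasFPowerSeriesOnBall_toFun (hγ : 0 < γ) (b : SeqSpace) :
    HasFPowerSeriesOnBall (toFun γ b)
      (.ofScalars ℂ fun n => (√(ccoef γ n) * b n : ℂ)) 0 1 := by
  refine ⟨?_, one_pos, ?_⟩
  · refine le_of_forall_lt_imp_le_of_dense fun r hr => ?_
    lift r to ℝ≥0 using (hr.trans ENNReal.one_lt_top).ne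
    have hr' : (r : ℝ) < 1 := by exact_mod_cast hr
    refine FormalMultilinearSeries.le_radius_of_summable_norm _ ?_
    have h := (hasSum_toFun hγ b (z := (r : ℂ)) (by simpa using hr')).summable.norm
    refine h.congr fun n => ?_
    simp
  · intro y hy
    have hy' : ‖y‖ < 1 := by
      simpa [Metric.mem_eball, enorm_eq_nnnorm, ← NNReal.coe_lt_coe] using hy
    simpa [FormalMultilinearSeries.ofScalars_apply_eq, mul_comm] using hasSum_toFun hγ b hy'

lemma differentiableOn_toFun (hγ : 0 < γ) (b : SeqSpace) :
    DifferentiableOn ℂ (toFun γ b) unitDisk := by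
  have h := (hasFPowerSeriesOnBall_toFun hγ b).differentiableOn
  have e : Metric.eball (0 : ℂ) 1 = unitDisk := by
    rw [unitDisk, ← Metric.eball_ofReal]; simp
  rwa [e] at h

lemma taylorCoeff_toFun (hγ : 0 < γ) (b : SeqSpace) (n : ℕ) :
    taylorCoeff (toFun γ b) n = √(ccoef γ n) * b n := by
  have h := (hasFPowerSeriesOnBall_toFun hγ b).hasFPowerSeriesAt
  have h2 := h.analyticAt.hasFPowerSeriesAt
  have h3 := h.eq_formalMultilinearSeries h2
  exact (congrFun (FormalMultilinearSeries.ofScalars_series_injective ℂ ℂ h3) n).symm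

lemma iteratedDeriv_toFun (hγ : 0 < γ) (b : SeqSpace) (n : ℕ) :
    iteratedDeriv n (toFun γ b) 0 = n.factorial * (√(ccoef γ n) * b n) := by
  have hn : (n.factorial : ℂ) ≠ 0 := by exact_mod_cast n.factorial_ne_zero
  rw [← taylorCoeff_toFun hγ, taylorCoeff, mul_div_cancel₀ _ hn]

lemma A2norm_toFun {α : ℝ} (hα : 0 < α + 2) (b : SeqSpace) :
    A2norm α (toFun (α + 2) b) = ENNReal.ofReal ‖b‖ := by
  have h : A2normSq α (toFun (α + 2) b) = ENNReal.ofReal (‖b‖ ^ 2) := by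
    have hs := lp.hasSum_norm (p := 2) (by norm_num) b
    simp only [ENNReal.toReal_ofNat, Real.rpow_ofNat] at hs
    rw [A2normSq, ← hs.tsum_eq, ENNReal.ofReal_tsum_of_nonneg (fun _ => by positivity) hs.summable]
    refine tsum_congr fun n => ?_
    have hc := ccoef_pos hα n
    rw [taylorCoeff_toFun hα, norm_mul, mul_pow, Complex.norm_real, Real.norm_eq_abs, sq_abs,
      Real.sq_sqrt hc.le, mul_div_cancel_left₀ _ hc.ne']
  rw [A2norm, h, ENNReal.ofReal_rpow_of_nonneg (by positivity) (by norm_num),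
    ← Real.sqrt_eq_rpow, Real.sqrt_sq (norm_nonneg _)]

lemma exists_toFun_eq {α : ℝ} (hα : 0 < α + 2) {f : ℂ → ℂ} (hf : DifferentiableOn ℂ f unitDisk)
    (hn : A2norm α f ≤ 1) :
    ∃ b : SeqSpace, ‖b‖ ≤ 1 ∧ EqOn f (toFun (α + 2) b) unitDisk := by
  have hsq : A2normSq α f ≤ 1 := by
    by_contra! h
    exact absurd (ENNReal.one_lt_rpow h (by norm_num : (0 : ℝ) < 1 / 2)) (not_lt.2 hn)
  have hmem : Memℓp (fun n : ℕ => taylorCoeff f n / (√(ccoef (α + 2) n) : ℂ)) 2 := by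
    refine memℓp_gen ?_
    have := ENNReal.summable_toReal (hsq.trans_lt ENNReal.one_lt_top).ne
    refine this.congr fun n => ?_
    have hc := ccoef_pos hα n
    rw [ENNReal.toReal_ofReal (by positivity)]
    simp [div_pow, Real.sq_sqrt hc.le]
  let b : SeqSpace := ⟨_, hmem⟩
  have hb (n : ℕ) : (√(ccoef (α + 2) n) : ℂ) * b n = taylorCoeff f n := by
    have : (√(ccoef (α + 2) n) : ℂ) ≠ 0 := by
      exact_mod_cast (Real.sqrt_pos.2 (ccoef_pos hα n)).ne'
    exact mul_div_cancel₀ _ this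
  refine ⟨b, ?_, ?_⟩
  · have h1 : A2norm α (toFun (α + 2) b) = A2norm α f := by
      simp only [A2norm, A2normSq, taylorCoeff_toFun hα, hb]
    rw [A2norm_toFun hα] at h1
    simpa [h1] using ENNReal.ofReal_le_one.1 (h1.trans_le hn)
  · intro z hz
    have hz' : ‖z‖ < 1 := by simpa [unitDisk] using hz
    have h1 := Complex.hasSum_taylorSeries_on_ball hf hz
    refine (h1.congr_fun fun n => ?_).unique (hasSum_toFun hα b hz')
    rw [hb, taylorCoeff]
    simp
    ring

end Coefficients
section Moebius

/-- The involutive automorphism of the disk exchanging `0` and the real point `a`. -/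
def moeb (a : ℝ) (z : ℂ) : ℂ := (a - z) / (1 - a * z)

variable {a : ℝ} {z w : ℂ}

lemma re_one_sub_pos {u : ℂ} (hu : ‖u‖ < 1) : 0 < (1 - u).re := by
  have := (Complex.abs_re_le_norm u).trans_lt hu
  have := (abs_lt.1 this).2
  simp only [Complex.sub_re, Complex.one_re]
  linarith

lemma norm_mul_lt_one {u v : ℂ} (hu : ‖u‖ < 1) (hv : ‖v‖ < 1) : ‖u * v‖ < 1 := by
  rw [norm_mul]; nlinarith [norm_nonneg u, norm_nonneg v]

lemma one_sub_ne_zero_of_norm_lt_one {u : ℂ} (hu : ‖u‖ < 1) : 1 - u ≠ 0 := fun h => by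
  have := re_one_sub_pos hu
  simp [h] at this

lemma norm_ofReal_lt_one (ha0 : 0 < a) (ha1 : a < 1) : ‖(a : ℂ)‖ < 1 := by
  simpa [abs_of_pos ha0] using ha1

lemma one_sub_norm_moeb_sq (ha0 : 0 < a) (ha1 : a < 1) (hz : ‖z‖ < 1) :
    1 - ‖moeb a z‖ ^ 2 = (1 - a ^ 2) * (1 - ‖z‖ ^ 2) / ‖1 - a * z‖ ^ 2 := by
  have h := one_sub_ne_zero_of_norm_lt_one (norm_mul_lt_one (norm_ofReal_lt_one ha0 ha1) hz)
  have h' : ‖1 - a * z‖ ^ 2 ≠ 0 := by positivity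
  rw [moeb, norm_div, div_pow, eq_div_iff h', sub_mul, div_mul_cancel₀ _ h']
  simp only [← Complex.normSq_eq_norm_sq, Complex.normSq_apply, Complex.sub_re, Complex.sub_im,
    Complex.mul_re, Complex.mul_im, Complex.ofReal_re, Complex.ofReal_im, Complex.one_re,
    Complex.one_im]
  ring

lemma norm_moeb_lt_one (ha0 : 0 < a) (ha1 : a < 1) (hz : ‖z‖ < 1) : ‖moeb a z‖ < 1 := by
  have h := one_sub_ne_zero_of_norm_lt_one (norm_mul_lt_one (norm_ofReal_lt_one ha0 ha1) hz)
  have h1 := one_sub_norm_moeb_sq ha0 ha1 hz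
  have h2 : 0 < 1 - a ^ 2 := by nlinarith
  have h3 : 0 < 1 - ‖z‖ ^ 2 := by nlinarith [norm_nonneg z]
  have h4 : 0 < 1 - ‖moeb a z‖ ^ 2 := by rw [h1]; positivity
  nlinarith [norm_nonneg (moeb a z)]

lemma one_sub_mul_moeb (ha0 : 0 < a) (ha1 : a < 1) (hz : ‖z‖ < 1) :
    (1 - a * moeb a z) * (1 - a * z) = (1 - a ^ 2 : ℝ) := by
  have h := one_sub_ne_zero_of_norm_lt_one (norm_mul_lt_one (norm_ofReal_lt_one ha0 ha1) hz)
  rw [moeb]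
  field_simp
  push_cast
  ring

lemma moeb_moeb (ha0 : 0 < a) (ha1 : a < 1) (hz : ‖z‖ < 1) : moeb a (moeb a z) = z := by
  have h := one_sub_ne_zero_of_norm_lt_one (norm_mul_lt_one (norm_ofReal_lt_one ha0 ha1) hz)
  have h2 := one_sub_ne_zero_of_norm_lt_one
    (norm_mul_lt_one (norm_ofReal_lt_one ha0 ha1) (norm_moeb_lt_one ha0 ha1 hz))
  rw [moeb, div_eq_iff h2]
  rw [moeb]
  field_simp
  ring

lemma image_moeb (ha0 : 0 < a) (ha1 : a < 1) : moeb a '' unitDisk = unitDisk := by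
  refine Subset.antisymm ?_ ?_
  · rintro _ ⟨z, hz, rfl⟩
    simpa [unitDisk] using norm_moeb_lt_one ha0 ha1 (by simpa [unitDisk] using hz)
  · intro z hz
    have hz' : ‖z‖ < 1 := by simpa [unitDisk] using hz
    exact ⟨moeb a z, by simpa [unitDisk] using norm_moeb_lt_one ha0 ha1 hz',
      moeb_moeb ha0 ha1 hz'⟩

lemma injOn_moeb (ha0 : 0 < a) (ha1 : a < 1) : InjOn (moeb a) unitDisk := by
  intro z hz w hw h
  have hz' : ‖z‖ < 1 := by simpa [unitDisk] using hz
  have hw' : ‖w‖ < 1 := by simpa [unitDisk] using hw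
  rw [← moeb_moeb ha0 ha1 hz', h, moeb_moeb ha0 ha1 hw']

lemma hasDerivAt_moeb (ha0 : 0 < a) (ha1 : a < 1) (hz : ‖z‖ < 1) :
    HasDerivAt (moeb a) ((a ^ 2 - 1) / (1 - a * z) ^ 2) z := by
  have h := one_sub_ne_zero_of_norm_lt_one (norm_mul_lt_one (norm_ofReal_lt_one ha0 ha1) hz)
  have h1 : HasDerivAt (fun z : ℂ => (a : ℂ) - z) (-1) z := (hasDerivAt_id z).const_sub _
  have h2 : HasDerivAt (fun z : ℂ => 1 - (a : ℂ) * z) (-(a * 1)) z :=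
    ((hasDerivAt_id z).const_mul _).const_sub _
  refine (h1.div h2 h).congr_deriv ?_
  congr 1
  ring

lemma lintegral_comp_moeb (ha0 : 0 < a) (ha1 : a < 1) (g : ℂ → ℝ≥0∞) :
    ∫⁻ z in unitDisk, g z =
      ∫⁻ z in unitDisk, ENNReal.ofReal ((1 - a ^ 2) ^ 2 / ‖1 - a * z‖ ^ 4) * g (moeb a z) := by
  have hm : MeasurableSet unitDisk := Metric.isOpen_ball.measurableSet
  conv_lhs => rw [← image_moeb ha0 ha1]
  rw [lintegral_image_eq_lintegral_abs_det_fderiv_mul volume hm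
    (f' := fun z => (ContinuousLinearMap.toSpanSingleton ℂ
      (((a : ℂ) ^ 2 - 1) / (1 - a * z) ^ 2)).restrictScalars ℝ) ?_ (injOn_moeb ha0 ha1)]
  · refine setLIntegral_congr_fun hm fun z hz => ?_
    have hdet : ((ContinuousLinearMap.toSpanSingleton ℂ
      (((a : ℂ) ^ 2 - 1) / (1 - a * z) ^ 2)).restrictScalars ℝ).det =
        (1 - a ^ 2) ^ 2 / ‖1 - a * z‖ ^ 4 := by
      have : ‖(a : ℂ) ^ 2 - 1‖ ^ 2 = (1 - a ^ 2) ^ 2 := by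
        rw [show (a : ℂ) ^ 2 - 1 = ((a ^ 2 - 1 : ℝ) : ℂ) by push_cast; ring, Complex.norm_real,
          Real.norm_eq_abs, sq_abs]
        ring
      simp [ContinuousLinearMap.det, LinearMap.det_restrictScalars,
        Algebra.norm_complex_eq, Complex.normSq_eq_norm_sq, ← pow_mul, this]
    simp only [hdet]
    rw [abs_of_nonneg (by positivity)]
  · intro z hz
    exact ((hasDerivAt_moeb ha0 ha1 (by simpa [unitDisk] using hz)).hasFDerivAt.restrictScalars
      ℝ).hasFDerivWithinAt

lemma cpow_mul_cpow_of_mul_eq {x y u v : ℂ} (hx : 0 < x.re) (hy : 0 < y.re) (hu : 0 < u.re)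
    (hv : 0 < v.re) (h : x * y = u * v) (s : ℂ) : x ^ s * y ^ s = u ^ s * v ^ s := by
  have ne {t : ℂ} (ht : 0 < t.re) : t ≠ 0 := by rintro rfl; simp at ht
  have him {t : ℂ} (ht : 0 < t.re) : |t.arg| < Real.pi / 2 :=
    Complex.abs_arg_lt_pi_div_two_iff.2 (Or.inl ht)
  have hmul {s t : ℂ} (hs : 0 < s.re) (ht : 0 < t.re) :
      Complex.log (s * t) = Complex.log s + Complex.log t := by
    have h1 := abs_lt.1 (him hs)
    have h2 := abs_lt.1 (him ht)
    exact Complex.log_mul (ne hs) (ne ht) ⟨by linarith, by linarith⟩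
  have hlog : Complex.log x + Complex.log y = Complex.log u + Complex.log v := by
    rw [← hmul hx hy, h, hmul hu hv]
  rw [Complex.cpow_def_of_ne_zero (ne hx), Complex.cpow_def_of_ne_zero (ne hy),
    Complex.cpow_def_of_ne_zero (ne hu), Complex.cpow_def_of_ne_zero (ne hv), ← Complex.exp_add,
    ← Complex.exp_add, ← add_mul, ← add_mul, hlog]

lemma toFun_moeb {γ : ℝ} (hγ : 0 < γ) (ha0 : 0 < a) (ha1 : a < 1) (hz : ‖z‖ < 1) (hw : ‖w‖ < 1) :
    1 / (1 - a * z) ^ (γ : ℂ) * toFun γ (kerVec γ w) (moeb a z) =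
      1 / (1 - a * starRingEnd ℂ w) ^ (γ : ℂ) * toFun γ (kerVec γ (moeb a w)) z := by
  have hw' : ‖starRingEnd ℂ w‖ < 1 := by rwa [RCLike.norm_conj]
  have haz := norm_mul_lt_one (norm_ofReal_lt_one ha0 ha1) hz
  have haw := norm_mul_lt_one (norm_ofReal_lt_one ha0 ha1) hw'
  have h1 := norm_moeb_lt_one ha0 ha1 hz
  have h2 := norm_moeb_lt_one ha0 ha1 hw
  have h2' : ‖starRingEnd ℂ (moeb a w)‖ < 1 := by rwa [RCLike.norm_conj]
  rw [toFun_kerVec hγ h1 hw, toFun_kerVec hγ hz h2, one_div_mul_one_div, one_div_mul_one_div]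
  congr 1
  refine cpow_mul_cpow_of_mul_eq (re_one_sub_pos haz) (re_one_sub_pos (norm_mul_lt_one hw' h1))
    (re_one_sub_pos haw) (re_one_sub_pos (norm_mul_lt_one h2' hz)) ?_ _
  have e1 := one_sub_ne_zero_of_norm_lt_one haz
  have e2 := one_sub_ne_zero_of_norm_lt_one haw
  simp only [moeb, map_div₀, map_sub, map_mul, map_one, Complex.conj_ofReal]
  field_simp
  ring

/-- The factor by which the Möbius action multiplies the kernel vector at `w`. -/
def moebFactor (γ a : ℝ) (w : ℂ) : ℂ :=
  ((1 - a ^ 2) ^ (γ / 2) : ℝ) * (1 / (1 - a * starRingEnd ℂ w) ^ (γ : ℂ))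

lemma conj_moebFactor (γ : ℝ) (ha0 : 0 < a) (ha1 : a < 1) (hz : ‖z‖ < 1) :
    starRingEnd ℂ (moebFactor γ a z) =
      ((1 - a ^ 2) ^ (γ / 2) : ℝ) * (1 / (1 - a * z) ^ (γ : ℂ)) := by
  have hz' : ‖starRingEnd ℂ z‖ < 1 := by rwa [RCLike.norm_conj]
  have h := re_one_sub_pos (norm_mul_lt_one (norm_ofReal_lt_one ha0 ha1) hz)
  have harg : (1 - a * z).arg ≠ Real.pi := by
    have := (abs_lt.1 (Complex.abs_arg_lt_pi_div_two_iff.2 (Or.inl h))).2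
    linarith [Real.pi_pos]
  have hc := Complex.conj_cpow (1 - a * z) (γ : ℂ) harg
  simp only [map_sub, map_mul, map_one, Complex.conj_ofReal] at hc
  simp [moebFactor, hc]

lemma moebFactor_mul_toFun {γ : ℝ} (hγ : 0 < γ) (ha0 : 0 < a) (ha1 : a < 1) (hz : ‖z‖ < 1)
    (hw : ‖w‖ < 1) :
    moebFactor γ a w * toFun γ (kerVec γ (moeb a w)) z =
      starRingEnd ℂ (moebFactor γ a z) * toFun γ (kerVec γ w) (moeb a z) := by
  rw [conj_moebFactor γ ha0 ha1 hz, mul_assoc, toFun_moeb hγ ha0 ha1 hz hw, moebFactor, mul_assoc]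

lemma conj_moebFactor_mul_moebFactor_moeb {γ : ℝ} (ha0 : 0 < a) (ha1 : a < 1) (hz : ‖z‖ < 1) :
    starRingEnd ℂ (moebFactor γ a z) * starRingEnd ℂ (moebFactor γ a (moeb a z)) = 1 := by
  have h1 := norm_moeb_lt_one ha0 ha1 hz
  have hpos : 0 < 1 - a ^ 2 := by nlinarith
  have haz := norm_mul_lt_one (norm_ofReal_lt_one ha0 ha1) hz
  have haz' := norm_mul_lt_one (norm_ofReal_lt_one ha0 ha1) h1
  have key := cpow_mul_cpow_of_mul_eq (re_one_sub_pos haz') (re_one_sub_pos haz)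
    (u := ((1 - a ^ 2 : ℝ) : ℂ)) (v := 1) (by simpa only [Complex.ofReal_re] using hpos) (by simp)
    (by rw [one_sub_mul_moeb ha0 ha1 hz, mul_one]) γ
  rw [Complex.one_cpow, mul_one, ← Complex.ofReal_cpow hpos.le] at key
  rw [conj_moebFactor γ ha0 ha1 hz, conj_moebFactor γ ha0 ha1 h1]
  have hsq : (1 - a ^ 2) ^ (γ / 2) * (1 - a ^ 2) ^ (γ / 2) = (1 - a ^ 2) ^ γ := by
    rw [← Real.rpow_add hpos]; ring_nf
  have hne : (((1 - a ^ 2) ^ γ : ℝ) : ℂ) ≠ 0 := by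
    exact_mod_cast (Real.rpow_pos_of_pos hpos γ).ne'
  rw [mul_mul_mul_comm, ← Complex.ofReal_mul, hsq, one_div_mul_one_div, mul_comm (_ ^ _) (_ ^ _),
    key, mul_one_div_cancel hne]

lemma toFun_kerVec_moeb_moeb {γ : ℝ} (hγ : 0 < γ) (ha0 : 0 < a) (ha1 : a < 1) (hz : ‖z‖ < 1)
    (hw : ‖w‖ < 1) :
    starRingEnd ℂ (moebFactor γ a z) * moebFactor γ a w *
      toFun γ (kerVec γ (moeb a w)) (moeb a z) = toFun γ (kerVec γ w) z := by
  rw [mul_assoc, moebFactor_mul_toFun hγ ha0 ha1 (norm_moeb_lt_one ha0 ha1 hz) hw,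
    moeb_moeb ha0 ha1 hz, ← mul_assoc, conj_moebFactor_mul_moebFactor_moeb ha0 ha1 hz, one_mul]

lemma norm_moebFactor (γ : ℝ) (ha0 : 0 < a) (ha1 : a < 1) :
    ‖moebFactor γ a z‖ = (1 - a ^ 2) ^ (γ / 2) / ‖1 - a * z‖ ^ γ := by
  have hpos : 0 < 1 - a ^ 2 := by nlinarith
  have : ‖1 - a * starRingEnd ℂ z‖ = ‖1 - a * z‖ := by
    rw [← RCLike.norm_conj (1 - a * z)]; simp
  rw [moebFactor, norm_mul, norm_div, Complex.norm_cpow_real, this, Complex.norm_real, norm_one,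
    Real.norm_of_nonneg (by positivity), mul_one_div]

end Moebius

section KernelCombination

variable {γ a : ℝ} {z : ℂ}

/-- A finite linear combination of kernel vectors. -/
def kerComb (γ : ℝ) (s : Finset unitDisk) (c : unitDisk → ℂ) : SeqSpace :=
  ∑ w ∈ s, c w • kerVec γ w

/-- The image of a finite linear combination of kernel vectors under the Möbius action. -/
def moebComb (γ a : ℝ) (s : Finset unitDisk) (c : unitDisk → ℂ) : SeqSpace :=
  ∑ w ∈ s, (c w * moebFactor γ a w) • kerVec γ (moeb a w)

lemma norm_coe_lt_one (w : unitDisk) : ‖(w : ℂ)‖ < 1 := by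
  simpa [unitDisk] using w.2

lemma toFun_moebComb (hγ : 0 < γ) (ha0 : 0 < a) (ha1 : a < 1) (hz : ‖z‖ < 1)
    (s : Finset unitDisk) (c : unitDisk → ℂ) :
    toFun γ (moebComb γ a s c) z =
      starRingEnd ℂ (moebFactor γ a z) * toFun γ (kerComb γ s c) (moeb a z) := by
  have key (w : unitDisk) := moebFactor_mul_toFun hγ ha0 ha1 hz (norm_coe_lt_one w)
  simp only [toFun, moebComb, kerComb, inner_sum, inner_smul_right, Finset.mul_sum, mul_assoc]
    at key ⊢
  simp only [key]
  exact Finset.sum_congr rfl fun w _ => by ring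

lemma norm_moebComb (hγ : 0 < γ) (ha0 : 0 < a) (ha1 : a < 1)
    (s : Finset unitDisk) (c : unitDisk → ℂ) : ‖moebComb γ a s c‖ = ‖kerComb γ s c‖ := by
  have key (v w : unitDisk) :=
    toFun_kerVec_moeb_moeb hγ ha0 ha1 (norm_coe_lt_one v) (norm_coe_lt_one w)
  rw [← sq_eq_sq₀ (norm_nonneg _) (norm_nonneg _), ← Complex.ofReal_inj]
  push_cast
  have e (b : SeqSpace) : ((‖b‖ : ℝ) : ℂ) ^ 2 = inner ℂ b b :=
    (inner_self_eq_norm_sq_to_K (𝕜 := ℂ) b).symm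
  rw [e, e]
  simp only [toFun, moebComb, kerComb, inner_sum, sum_inner, inner_smul_right, inner_smul_left,
    Finset.mul_sum] at key ⊢
  refine Finset.sum_congr rfl fun v _ => Finset.sum_congr rfl fun w _ => ?_
  rw [← key w v, map_mul]
  ring

lemma norm_moebComb_apply_le (hγ : 0 < γ) (ha0 : 0 < a) (ha1 : a < 1)
    (s : Finset unitDisk) (c : unitDisk → ℂ) (n : ℕ) :
    ‖moebComb γ a s c n‖ ≤
      (1 - a ^ 2) ^ (γ / 2) * ∑ w ∈ s, ‖c w‖ / (1 - ‖(w : ℂ)‖) ^ γ * √(ccoef γ n) := by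
  have hpos : 0 < 1 - a ^ 2 := by nlinarith
  rw [moebComb, lp.coeFn_sum, Finset.sum_apply, Finset.mul_sum]
  refine (norm_sum_le _ _).trans (Finset.sum_le_sum fun w _ => ?_)
  have hw := norm_coe_lt_one w
  have hm := norm_moeb_lt_one ha0 ha1 hw
  have h1 : 1 - ‖(w : ℂ)‖ ≤ ‖1 - a * (w : ℂ)‖ := by
    have := norm_sub_norm_le (1 : ℂ) (a * w)
    rw [norm_one, norm_mul, Complex.norm_real, Real.norm_of_nonneg ha0.le] at this
    nlinarith [norm_nonneg (w : ℂ)]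
  have h2 : 0 < 1 - ‖(w : ℂ)‖ := by linarith
  have h3 : ‖moeb a w‖ ^ n ≤ 1 := pow_le_one₀ (norm_nonneg _) hm.le
  rw [lp.coeFn_smul, Pi.smul_apply, norm_smul, norm_mul, norm_moebFactor γ ha0 ha1,
    kerVec_apply hγ hm, norm_mul, norm_pow, RCLike.norm_conj, Complex.norm_real,
    Real.norm_of_nonneg (Real.sqrt_nonneg _)]
  calc ‖c w‖ * ((1 - a ^ 2) ^ (γ / 2) / ‖1 - a * (w : ℂ)‖ ^ γ) *
        (√(ccoef γ n) * ‖moeb a w‖ ^ n)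
      ≤ ‖c w‖ * ((1 - a ^ 2) ^ (γ / 2) / (1 - ‖(w : ℂ)‖) ^ γ) * (√(ccoef γ n) * 1) := by
        gcongr
    _ = _ := by ring

lemma dense_kerComb (hγ : 0 < γ) :
    Dense {b : SeqSpace | ∃ s c, b = kerComb γ s c} := by
  have h : (Submodule.span ℂ (range fun w : unitDisk => kerVec γ w)).topologicalClosure = ⊤ := by
    rw [Submodule.topologicalClosure_eq_top_iff, Submodule.eq_bot_iff]
    intro b hb
    rw [Submodule.mem_orthogonal] at hb
    have h0 : EqOn (toFun γ b) 0 unitDisk := fun z hz =>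
      hb _ (Submodule.subset_span ⟨⟨z, hz⟩, rfl⟩)
    have hev : toFun γ b =ᶠ[𝓝 0] fun _ => 0 :=
      h0.eventuallyEq_of_mem (Metric.isOpen_ball.mem_nhds (by simp))
    ext n
    have h1 := taylorCoeff_toFun hγ b n
    rw [taylorCoeff, hev.iteratedDeriv_eq n] at h1
    have : (√(ccoef γ n) : ℂ) ≠ 0 := by
      exact_mod_cast (Real.sqrt_pos.2 (ccoef_pos hγ n)).ne'
    simpa [this] using h1
  have h' : Dense ((Submodule.span ℂ (range fun w : unitDisk => kerVec γ w)) : Set SeqSpace) :=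
    Submodule.dense_iff_topologicalClosure_eq_top.2 h
  refine h'.mono fun b hb => ?_
  obtain ⟨c, hc⟩ := Finsupp.mem_span_range_iff_exists_finsupp.1 hb
  exact ⟨c.support, c, hc.symm⟩

end KernelCombination

section BergmanNorm

variable {p β : ℝ} {f g h : ℂ → ℂ}

lemma measurableSet_unitDisk : MeasurableSet unitDisk := Metric.isOpen_ball.measurableSet

lemma ApNorm_mono (hp : 0 < p) (hfg : ∀ z ∈ unitDisk, ‖f z‖ ≤ ‖g z‖) :
    ApNorm p β f ≤ ApNorm p β g := by
  unfold ApNorm ApIntPow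
  refine ENNReal.rpow_le_rpow ?_ (by positivity)
  gcongr ENNReal.ofReal (β + 1) * ?_ / ENNReal.ofReal Real.pi
  refine setLIntegral_mono' measurableSet_unitDisk fun z hz => ENNReal.ofReal_le_ofReal ?_
  have hz' : ‖z‖ < 1 := by simpa [unitDisk] using hz
  have : 0 ≤ 1 - ‖z‖ ^ 2 := by nlinarith [norm_nonneg z]
  gcongr
  exact hfg z hz

lemma ApNorm_congr (hp : 0 < p) (hfg : ∀ z ∈ unitDisk, ‖f z‖ = ‖g z‖) :
    ApNorm p β f = ApNorm p β g :=
  le_antisymm (ApNorm_mono hp fun z hz => (hfg z hz).le)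
    (ApNorm_mono hp fun z hz => (hfg z hz).ge)

lemma ApNorm_eq_eLpNorm (hp : 0 < p) :
    ApNorm p β f = (ENNReal.ofReal (β + 1) / ENNReal.ofReal Real.pi) ^ (1 / p) *
      eLpNorm (fun z => ((1 - ‖z‖ ^ 2) ^ (β / p) : ℝ) • f z) (ENNReal.ofReal p)
        (volume.restrict unitDisk) := by
  rw [eLpNorm_eq_lintegral_rpow_enorm_toReal (by simpa using hp) ENNReal.ofReal_ne_top,
    ENNReal.toReal_ofReal hp.le, ← ENNReal.mul_rpow_of_nonneg _ _ (by positivity), ApNorm,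
    ApIntPow, ENNReal.mul_div_right_comm]
  congr 2
  refine setLIntegral_congr_fun measurableSet_unitDisk fun z hz => ?_
  have hz' : ‖z‖ < 1 := by simpa [unitDisk] using hz
  have hpos : 0 < 1 - ‖z‖ ^ 2 := by nlinarith [norm_nonneg z]
  rw [← ofReal_norm, ENNReal.ofReal_rpow_of_nonneg (norm_nonneg _) hp.le, norm_smul,
    Real.norm_of_nonneg (by positivity), Real.mul_rpow (by positivity) (norm_nonneg _),
    ← Real.rpow_mul hpos.le, div_mul_cancel₀ _ hp.ne']

lemma ApNorm_const_mul (hp : 0 < p) (c : ℂ) :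
    ApNorm p β (fun z => c * f z) = ‖c‖ₑ * ApNorm p β f := by
  have : (fun z : ℂ => ((1 - ‖z‖ ^ 2) ^ (β / p) : ℝ) • (c * f z)) =
      c • fun z : ℂ => ((1 - ‖z‖ ^ 2) ^ (β / p) : ℝ) • f z := by
    ext z
    simp only [Pi.smul_apply, smul_eq_mul, Complex.real_smul]
    ring
  rw [ApNorm_eq_eLpNorm hp, ApNorm_eq_eLpNorm hp, this, eLpNorm_const_smul]
  ring

lemma aestronglyMeasurable_weight_smul (hf : DifferentiableOn ℂ f unitDisk) :
    AEStronglyMeasurable (fun z => ((1 - ‖z‖ ^ 2) ^ (β / p) : ℝ) • f z)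
      (volume.restrict unitDisk) := by
  have h1 := hf.continuousOn.aestronglyMeasurable (μ := volume) measurableSet_unitDisk
  have h2 : Measurable fun z : ℂ => ((1 - ‖z‖ ^ 2) ^ (β / p) : ℝ) := by fun_prop
  exact h2.aestronglyMeasurable.smul h1

lemma ApNorm_le_add (hp : 1 ≤ p) (hg : DifferentiableOn ℂ g unitDisk)
    (hh : DifferentiableOn ℂ h unitDisk) (hf : ∀ z, f z = g z + h z) :
    ApNorm p β f ≤ ApNorm p β g + ApNorm p β h := by
  have hp0 : 0 < p := by linarith
  rw [ApNorm_eq_eLpNorm hp0, ApNorm_eq_eLpNorm hp0, ApNorm_eq_eLpNorm hp0, ← mul_add]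
  gcongr
  have := eLpNorm_add_le (p := ENNReal.ofReal p)
    (aestronglyMeasurable_weight_smul (p := p) (β := β) hg)
    (aestronglyMeasurable_weight_smul (p := p) (β := β) hh) (by simpa using hp)
  refine le_trans (le_of_eq ?_) this
  congr 1
  ext z
  simp [hf]

lemma ApNorm_le_liminf (hp : 0 < p) {F : ℕ → ℂ → ℂ}
    (hF : ∀ n, DifferentiableOn ℂ (F n) unitDisk)
    (hlim : ∀ z ∈ unitDisk, Tendsto (fun n => F n z) atTop (𝓝 (f z))) :
    ApNorm p β f ≤ liminf (fun n => ApNorm p β (F n)) atTop := by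
  simp only [ApNorm_eq_eLpNorm hp]
  set K := (ENNReal.ofReal (β + 1) / ENNReal.ofReal Real.pi) ^ (1 / p) with hK
  have hK' : K ≠ ⊤ := by
    refine ENNReal.rpow_ne_top_of_nonneg (by positivity) (ENNReal.div_ne_top (by simp) ?_)
    simpa using Real.pi_pos
  rw [ENNReal.liminf_const_mul_of_ne_top hK']
  gcongr
  refine Lp.eLpNorm_lim_le_liminf_eLpNorm (fun n => aestronglyMeasurable_weight_smul (hF n)) _ ?_
  filter_upwards [ae_restrict_mem measurableSet_unitDisk] with z hz
  exact (hlim z hz).const_smul _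

lemma ApNorm_one_ne_top (hp : 0 < p) (hβ : -1 < β) : ApNorm p β (fun _ => 1) ≠ ⊤ := by
  have hint : IntegrableOn (fun z : ℂ => (fun r : ℝ => (1 - r ^ 2) ^ β) ‖z‖) unitDisk := by
    refine (integrableOn_fun_norm_addHaar volume (f := fun r : ℝ => (1 - r ^ 2) ^ β)).2 ?_
    rw [Complex.finrank_real_complex]
    have h1 : IntegrableOn (fun r : ℝ => (1 - r) ^ β) (Ioo 0 1) := by
      have h := (intervalIntegral.intervalIntegrable_rpow' (a := 0) (b := 1) hβ).comp_sub_left 1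
      simp only [sub_zero, sub_self] at h
      have := (intervalIntegrable_iff_integrableOn_Ioo_of_le zero_le_one).1 h.symm
      exact this
    have h2 : IntegrableOn (fun r : ℝ => (1 - r) ^ β * (r * (1 + r) ^ β)) (Icc 0 1) := by
      rw [integrableOn_Icc_iff_integrableOn_Ioo]
      refine h1.mul_continuousOn_of_subset (K := Icc 0 1) ?_ measurableSet_Ioo isCompact_Icc
        Ioo_subset_Icc_self
      refine continuousOn_id.mul (ContinuousOn.rpow_const (by fun_prop) fun x hx => Or.inl ?_)
      linarith [hx.1]
    refine (h2.mono_set Ioo_subset_Icc_self).congr_fun (fun r hr => ?_) measurableSet_Ioo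
    have e : 1 - r ^ 2 = (1 - r) * (1 + r) := by ring
    simp only [smul_eq_mul]
    rw [e, Real.mul_rpow (by linarith [hr.2]) (by linarith [hr.1])]
    ring
  have := hint.lintegral_lt_top
  unfold ApNorm ApIntPow
  refine ENNReal.rpow_ne_top_of_nonneg (by positivity) (ENNReal.div_ne_top ?_ ?_)
  · exact ENNReal.mul_ne_top ENNReal.ofReal_ne_top (by simpa using this.ne)
  · simpa using Real.pi_pos

lemma ApNorm_eq_of_moeb {γ a : ℝ} (ha0 : 0 < a) (ha1 : a < 1)
    (hfg : ∀ z ∈ unitDisk, ‖g z‖ = ‖moebFactor γ a z‖ * ‖f (moeb a z)‖) :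
    ApNorm p (p / 2 * γ - 2) g = ApNorm p (p / 2 * γ - 2) f := by
  unfold ApNorm ApIntPow
  congr 3
  rw [lintegral_comp_moeb ha0 ha1 fun z =>
    ENNReal.ofReal ((1 - ‖z‖ ^ 2) ^ (p / 2 * γ - 2) * ‖f z‖ ^ p)]
  refine setLIntegral_congr_fun measurableSet_unitDisk fun z hz => ?_
  have hz' : ‖z‖ < 1 := by simpa [unitDisk] using hz
  have hpos : 0 < 1 - ‖z‖ ^ 2 := by nlinarith [norm_nonneg z]
  have hapos : 0 < 1 - a ^ 2 := by nlinarith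
  have hne := one_sub_ne_zero_of_norm_lt_one (norm_mul_lt_one (norm_ofReal_lt_one ha0 ha1) hz')
  have hd : 0 < ‖1 - a * z‖ := by positivity
  rw [← ENNReal.ofReal_mul (by positivity), hfg z hz, norm_moebFactor γ ha0 ha1,
    one_sub_norm_moeb_sq ha0 ha1 hz', Real.mul_rpow (by positivity) (norm_nonneg _),
    Real.div_rpow (by positivity) (by positivity), Real.div_rpow (by positivity) (by positivity),
    Real.mul_rpow hapos.le hpos.le, ← Real.rpow_mul hapos.le, ← Real.rpow_mul hd.le,
    ← Real.rpow_natCast ‖1 - a * z‖ 2, ← Real.rpow_natCast ‖1 - a * z‖ 4, ← Real.rpow_mul hd.le,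
    ← Real.rpow_natCast (1 - a ^ 2) 2]
  have e1 : (1 - a ^ 2) ^ (γ / 2 * p) =
      (1 - a ^ 2) ^ ((2 : ℕ) : ℝ) * (1 - a ^ 2) ^ (p / 2 * γ - 2) := by
    rw [← Real.rpow_add hapos]; congr 1; push_cast; ring
  have e2 : ‖1 - a * z‖ ^ (γ * p) =
      ‖1 - a * z‖ ^ ((4 : ℕ) : ℝ) * ‖1 - a * z‖ ^ (((2 : ℕ) : ℝ) * (p / 2 * γ - 2)) := by
    rw [← Real.rpow_add hd]; congr 1; push_cast; ring
  rw [e1, e2]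
  congr 1
  field_simp

end BergmanNorm

section Truncation

variable {γ p : ℝ} {Λ : Finset ℕ}

lemma memℓp_tail (Λ : Finset ℕ) (b : SeqSpace) :
    Memℓp (fun n => if n ∈ Λ then 0 else b n) 2 := by
  refine memℓp_gen ?_
  have h := (lp.memℓp b).summable (p := 2) (by norm_num)
  refine h.of_nonneg_of_le (fun n => by positivity) fun n => ?_
  split_ifs
  · simp
  · rfl

/-- The sequence `b` with the entries indexed by `Λ` replaced by zero. -/
def tail (Λ : Finset ℕ) (b : SeqSpace) : SeqSpace := ⟨_, memℓp_tail Λ b⟩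

lemma tail_apply (b : SeqSpace) (n : ℕ) : tail Λ b n = if n ∈ Λ then 0 else b n := rfl

lemma norm_tail_le (b : SeqSpace) : ‖tail Λ b‖ ≤ ‖b‖ := by
  have h1 := lp.hasSum_norm (p := 2) (by norm_num) b
  have h2 := lp.hasSum_norm (p := 2) (by norm_num) (tail Λ b)
  simp only [ENNReal.toReal_ofNat, Real.rpow_ofNat] at h1 h2
  refine (sq_le_sq₀ (norm_nonneg _) (norm_nonneg _)).1 (hasSum_le (fun n => ?_) h2 h1)
  rw [tail_apply]
  split_ifs
  · simp
  · rfl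

lemma toFun_sub_tail (hγ : 0 < γ) (b : SeqSpace) {z : ℂ} (hz : ‖z‖ < 1) :
    toFun γ (b - tail Λ b) z = ∑ n ∈ Λ, (√(ccoef γ n) * b n : ℂ) * z ^ n := by
  refine (hasSum_toFun hγ _ hz).unique ?_
  have : ∀ n ∈ Λ, (√(ccoef γ n) * b n : ℂ) * z ^ n =
      (√(ccoef γ n) * (b - tail Λ b : SeqSpace) n : ℂ) * z ^ n := fun n hn => by
    simp [tail_apply, hn]
  rw [Finset.sum_congr rfl this]
  refine hasSum_sum_of_ne_finset_zero fun n hn => ?_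
  simp [tail_apply, hn]

lemma ApNorm_toFun_sub_tail_le (hγ : 0 < γ) (hp : 0 < p) (β : ℝ) (b : SeqSpace) :
    ApNorm p β (toFun γ (b - tail Λ b)) ≤
      ENNReal.ofReal (∑ n ∈ Λ, √(ccoef γ n) * ‖b n‖) * ApNorm p β fun _ => 1 := by
  set M := ∑ n ∈ Λ, √(ccoef γ n) * ‖b n‖ with hM
  have hM0 : 0 ≤ M := Finset.sum_nonneg fun _ _ => by positivity
  have h := ApNorm_const_mul (β := β) (f := fun _ => 1) hp (M : ℂ)
  rw [← ofReal_norm, Complex.norm_real, Real.norm_of_nonneg hM0] at h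
  rw [← h]
  refine ApNorm_mono hp fun z hz => ?_
  have hz' : ‖z‖ < 1 := by simpa [unitDisk] using hz
  rw [toFun_sub_tail hγ b hz', mul_one, Complex.norm_real, Real.norm_of_nonneg hM0, hM]
  refine (norm_sum_le _ _).trans (Finset.sum_le_sum fun n _ => ?_)
  rw [norm_mul, norm_mul, norm_pow, Complex.norm_real, Real.norm_of_nonneg (Real.sqrt_nonneg _)]
  exact mul_le_of_le_one_right (by positivity) (pow_le_one₀ (norm_nonneg _) hz'.le)

lemma ApNorm_kerComb_le (hγ : 1 ≤ γ) (hp : 2 < p) {S : ℝ≥0∞}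
    (hS : ∀ b : SeqSpace, (∀ n ∈ Λ, b n = 0) →
      ApNorm p (p / 2 * γ - 2) (toFun γ b) ≤ S * ENNReal.ofReal ‖b‖)
    (s : Finset unitDisk) (c : unitDisk → ℂ) :
    ApNorm p (p / 2 * γ - 2) (toFun γ (kerComb γ s c)) ≤
      S * ENNReal.ofReal ‖kerComb γ s c‖ := by
  have hγ0 : 0 < γ := by linarith
  have hp0 : 0 < p := by linarith
  set β := p / 2 * γ - 2 with hβ
  have hβ1 : -1 < β := by nlinarith
  have hC := ApNorm_one_ne_top hp0 hβ1
  set C := ApNorm p β fun _ => 1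
  let A : ℝ := ∑ n ∈ Λ,
    √(ccoef γ n) * ∑ w ∈ s, ‖c w‖ / (1 - ‖(w : ℂ)‖) ^ γ * √(ccoef γ n)
  have key : ∀ a ∈ Ioo (0 : ℝ) 1, ApNorm p β (toFun γ (kerComb γ s c)) ≤
      S * ENNReal.ofReal ‖kerComb γ s c‖ + ENNReal.ofReal ((1 - a ^ 2) ^ (γ / 2) * A) * C := by
    rintro a ⟨ha0, ha1⟩
    set b := moebComb γ a s c with hb
    have h1 : ApNorm p β (toFun γ b) = ApNorm p β (toFun γ (kerComb γ s c)) :=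
      ApNorm_eq_of_moeb ha0 ha1 fun z hz => by
        rw [toFun_moebComb hγ0 ha0 ha1 (by simpa [unitDisk] using hz), norm_mul, RCLike.norm_conj]
    have h2 : ApNorm p β (toFun γ b) ≤
        ApNorm p β (toFun γ (tail Λ b)) + ApNorm p β (toFun γ (b - tail Λ b)) :=
      ApNorm_le_add (by linarith) (differentiableOn_toFun hγ0 _) (differentiableOn_toFun hγ0 _)
        fun z => by simp [toFun]
    rw [← h1]
    refine h2.trans (add_le_add ?_ ?_)
    · refine (hS _ fun n hn => by simp [tail_apply, hn]).trans ?_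
      gcongr
      exact (norm_tail_le b).trans_eq (norm_moebComb hγ0 ha0 ha1 s c)
    · refine (ApNorm_toFun_sub_tail_le hγ0 hp0 β b).trans ?_
      gcongr
      rw [Finset.mul_sum]
      refine Finset.sum_le_sum fun n _ => ?_
      rw [mul_left_comm]
      gcongr
      exact norm_moebComb_apply_le hγ0 ha0 ha1 s c n
  have hlim : Tendsto (fun a : ℝ => S * ENNReal.ofReal ‖kerComb γ s c‖ +
      ENNReal.ofReal ((1 - a ^ 2) ^ (γ / 2) * A) * C) (𝓝[<] 1)
      (𝓝 (S * ENNReal.ofReal ‖kerComb γ s c‖ + 0)) := by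
    refine tendsto_const_nhds.add ?_
    have h1 : Tendsto (fun a : ℝ => (1 - a ^ 2) ^ (γ / 2) * A) (𝓝 1) (𝓝 0) := by
      have hcont : Continuous fun a : ℝ => (1 - a ^ 2) ^ (γ / 2) * A :=
        (Continuous.rpow_const (by fun_prop) fun _ => Or.inr (by positivity)).mul_const A
      have := hcont.tendsto 1
      simpa [Real.zero_rpow (by positivity : γ / 2 ≠ 0)] using this
    have h2 := ENNReal.Tendsto.mul_const (b := C)
      (ENNReal.tendsto_ofReal (h1.mono_left (nhdsWithin_le_nhds (s := Iio 1)))) (Or.inr hC)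
    simpa using h2
  rw [add_zero] at hlim
  exact ge_of_tendsto hlim (by
    filter_upwards [Ioo_mem_nhdsLT zero_lt_one] with a ha using key a ha)

lemma ApNorm_toFun_le (hγ : 1 ≤ γ) (hp : 2 < p) {S : ℝ≥0∞} (hStop : S ≠ ⊤)
    (hS : ∀ b : SeqSpace, (∀ n ∈ Λ, b n = 0) →
      ApNorm p (p / 2 * γ - 2) (toFun γ b) ≤ S * ENNReal.ofReal ‖b‖) (b : SeqSpace) :
    ApNorm p (p / 2 * γ - 2) (toFun γ b) ≤ S * ENNReal.ofReal ‖b‖ := by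
  have hγ0 : 0 < γ := by linarith
  obtain ⟨x, hx, hxb⟩ := mem_closure_iff_seq_limit.1 (dense_kerComb hγ0 b)
  have h1 : ApNorm p (p / 2 * γ - 2) (toFun γ b) ≤
      liminf (fun n => ApNorm p (p / 2 * γ - 2) (toFun γ (x n))) atTop :=
    ApNorm_le_liminf (by linarith) (fun n => differentiableOn_toFun hγ0 _)
      fun z _ => tendsto_const_nhds.inner hxb
  have h2 : Tendsto (fun n => S * ENNReal.ofReal ‖x n‖) atTop (𝓝 (S * ENNReal.ofReal ‖b‖)) :=
    ENNReal.Tendsto.const_mul (ENNReal.tendsto_ofReal hxb.norm) (Or.inr hStop)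
  refine h1.trans (h2.liminf_eq ▸ liminf_le_liminf (Eventually.of_forall fun n => ?_))
  obtain ⟨s, c, hsc⟩ := hx n
  simp only [hsc]
  exact ApNorm_kerComb_le hγ hp hS s c

end Truncation

/-- For a finite set Λ ⊂ ℕ, α ≥ -1 and p > 2, the supremum of
‖f‖_{A^p_{(p/2)(α+2)-2}} over holomorphic f on 𝔻 with ‖f‖_{A²_α} ≤ 1 equals the
supremum restricted to those f with f^{(j)}(0) = 0 for all j ∈ Λ. -/
theorem statement0 (Λ : Finset ℕ) (α p : ℝ) (hα : -1 ≤ α) (hp : 2 < p) :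
    sSup {x : ℝ≥0∞ | ∃ f : ℂ → ℂ, DifferentiableOn ℂ f unitDisk ∧
        A2norm α f ≤ 1 ∧ x = ApNorm p (p / 2 * (α + 2) - 2) f} =
      sSup {x : ℝ≥0∞ | ∃ f : ℂ → ℂ, DifferentiableOn ℂ f unitDisk ∧
        A2norm α f ≤ 1 ∧ (∀ j ∈ Λ, iteratedDeriv j f 0 = 0) ∧
        x = ApNorm p (p / 2 * (α + 2) - 2) f} := by
  have hγ : 1 ≤ α + 2 := by linarith
  have hγ0 : 0 < α + 2 := by linarith
  have hp0 : 0 < p := by linarith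
  refine le_antisymm ?_ (sSup_le_sSup ?_)
  swap
  · rintro x ⟨f, hf, hn, -, hx⟩
    exact ⟨f, hf, hn, hx⟩
  set S := sSup {x : ℝ≥0∞ | ∃ f : ℂ → ℂ, DifferentiableOn ℂ f unitDisk ∧
    A2norm α f ≤ 1 ∧ (∀ j ∈ Λ, iteratedDeriv j f 0 = 0) ∧
    x = ApNorm p (p / 2 * (α + 2) - 2) f}
  rcases eq_or_ne S ⊤ with hStop | hStop
  · rw [hStop]
    exact le_top
  have hS : ∀ b : SeqSpace, (∀ n ∈ Λ, b n = 0) →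
      ApNorm p (p / 2 * (α + 2) - 2) (toFun (α + 2) b) ≤ S * ENNReal.ofReal ‖b‖ := by
    intro b hb
    let c : SeqSpace := ((‖b‖⁻¹ : ℝ) : ℂ) • b
    have hbc : toFun (α + 2) b = fun z => ((‖b‖ : ℝ) : ℂ) * toFun (α + 2) c z := by
      ext z
      rcases eq_or_ne b 0 with rfl | h0
      · simp [toFun]
      · have : (‖b‖ : ℂ) ≠ 0 := by exact_mod_cast (norm_pos_iff.2 h0).ne'
        simp [toFun, c, this]
    have hc1 : ‖c‖ ≤ 1 := by
      rw [norm_smul, Complex.norm_real, norm_inv, norm_norm]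
      exact inv_mul_le_one
    have hcS : ApNorm p (p / 2 * (α + 2) - 2) (toFun (α + 2) c) ≤ S := by
      refine le_sSup ⟨_, differentiableOn_toFun hγ0 c, ?_, fun j hj => ?_, rfl⟩
      · rw [A2norm_toFun hγ0]
        exact ENNReal.ofReal_le_one.2 hc1
      · have hcj : c j = 0 := by
          rw [lp.coeFn_smul, Pi.smul_apply, hb j hj, smul_zero]
        rw [iteratedDeriv_toFun hγ0, hcj, mul_zero, mul_zero]
    rw [hbc, ApNorm_const_mul hp0, ← ofReal_norm, Complex.norm_real, norm_norm, mul_comm]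
    gcongr
  refine sSup_le ?_
  rintro x ⟨f, hf, hn, rfl⟩
  obtain ⟨b, hb, hfb⟩ := exists_toFun_eq hγ0 hf hn
  rw [ApNorm_congr hp0 fun z hz => congrArg norm (hfb hz)]
  refine (ApNorm_toFun_le hγ hp hStop hS b).trans (mul_le_of_le_one_right' ?_)
  exact ENNReal.ofReal_le_one.2 hb

end
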